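/- arXiv:2509.08572 — 3 statements merged into one kernel-verified Lean document; each statement's English description precedes it below -/
import Mathlib

section
/- Let T > 0 and let y : ℝ → ℝ^n be differentiable and satisfy, for all t ∈ [0, T], the differential equation y'(t) + q + Eᵀ Γ R_Eᵀ y(t) + (u_max/2) Hᵀ ( (R_Dᵀ y(t) + v) − |R_Dᵀ y(t) + v|_elem ) = 0 together with the terminal condition y(T) = c. Define V(x, t) := ⟨y(t), x⟩. Then for every t ∈ [0, T] and every x ∈ ℝ^n with nonnegative entries, V satisfies the finite-horizon Hamilton–Jacobi–Bellman equation: ⟨y'(t), x⟩ + inf over u ∈ [0, u_max]^{m_u} of [ ⟨q, x⟩ + Σ_{k=1}^{m_u} ( v_k + ⟨y(t), r_k^D⟩ ) u_k (Hx)_k + Σ_{j=1}^{m_e} γ_j (Ex)_j ⟨y(t), r_j^E⟩ ] = 0, and moreover V(x, T) = ⟨c, x⟩; in particular the infimum in the HJB equation is attained. -/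
open Matrix in
/-- Moving a transposed matrix across the dot product. -/
theorem transpose_mulVec_dotProduct {m n : Type*} [Fintype m] [Fintype n]
    (A : Matrix m n ℝ) (w : m → ℝ) (x : n → ℝ) :
    (Aᵀ *ᵥ w) ⬝ᵥ x = w ⬝ᵥ (A *ᵥ x) := by
  rw [mulVec_transpose, dotProduct_mulVec]

/-- The bang-bang control attains half of `a - |a|`, scaled by the bound `b`. -/
theorem mul_ite_nonpos_eq_half_sub_abs (a b : ℝ) :
    a * (if a ≤ 0 then b else 0) = b / 2 * (a - |a|) := by
  split_ifs with h
  · rw [abs_of_nonpos h]; ring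
  · rw [abs_of_pos (not_le.mp h)]; ring

/-- Every control in `[0, b]` costs at least as much as the bang-bang control. -/
theorem half_sub_abs_le_mul {a b u : ℝ} (hu : u ∈ Set.Icc 0 b) :
    b / 2 * (a - |a|) ≤ a * u := by
  rcases le_total a 0 with h | h
  · rw [abs_of_nonpos h]; nlinarith [hu.2]
  · rw [abs_of_nonneg h]; nlinarith [mul_nonneg h hu.1]


/-- Verification core of Proposition 1: if `y` solves the adjoint ODE with terminal condition
`y T = c`, then `V(x,t) = ⟨y(t), x⟩` satisfies the finite-horizon HJB equation at every
nonnegative state (with the infimum attained), and `V(x,T) = ⟨c, x⟩`. -/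
theorem finite_horizon_hjb_verification (n me mu : ℕ)
    (T : ℝ) (hT : 0 < T) (u_max : ℝ) (hu : 0 < u_max)
    (RE : Matrix (Fin n) (Fin me) ℝ) (RD : Matrix (Fin n) (Fin mu) ℝ)
    (gam : Fin me → ℝ) (hgam : ∀ j, 0 ≤ gam j)
    (E : Matrix (Fin me) (Fin n) ℝ) (hE : ∀ j i, E j i = 0 ∨ E j i = 1)
    (H : Matrix (Fin mu) (Fin n) ℝ) (hH : ∀ k i, H k i = 0 ∨ H k i = 1)
    (q : Fin n → ℝ) (hq : ∀ i, 0 ≤ q i)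
    (v : Fin mu → ℝ) (hv : ∀ k, 0 ≤ v k)
    (c : Fin n → ℝ) (hc : ∀ i, 0 ≤ c i)
    (y y' : ℝ → Fin n → ℝ)
    (hderiv : ∀ t, HasDerivAt y (y' t) t)
    (hode : ∀ t ∈ Set.Icc (0 : ℝ) T,
      y' t + q + (E.transpose * Matrix.diagonal gam * RE.transpose).mulVec (y t)
        + (u_max / 2) • H.transpose.mulVec
            (fun k => (RD.transpose.mulVec (y t) + v) k
              - |(RD.transpose.mulVec (y t) + v) k|) = 0)
    (hterm : y T = c) :
    ∀ x : Fin n → ℝ, (∀ i, 0 ≤ x i) →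
      (∀ t ∈ Set.Icc (0 : ℝ) T,
        ∃ mmin : ℝ,
          IsLeast {z : ℝ | ∃ u : Fin mu → ℝ, (∀ k, u k ∈ Set.Icc (0 : ℝ) u_max) ∧
              z = (∑ i, q i * x i)
                + (∑ k, (v k + ∑ i, y t i * RD i k) * u k * H.mulVec x k)
                + (∑ j, gam j * E.mulVec x j * (∑ i, y t i * RE i j))} mmin ∧
          (∑ i, y' t i * x i) + mmin = 0) ∧
      (∑ i, y T i * x i) = ∑ i, c i * x i := by
  intro x hx
  refine ⟨fun t ht => ?_, by rw [hterm]⟩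
  have hHx (k : Fin mu) : 0 ≤ H.mulVec x k :=
    dotProduct_nonneg_of_nonneg
      (fun i => by rcases hH k i with h | h <;> simp [h]) hx
  set a : Fin mu → ℝ := fun k => v k + ∑ i, y t i * RD i k with ha
  have haRD (k : Fin mu) : (RD.transpose.mulVec (y t) + v) k = a k := by
    simp [ha, Matrix.mulVec, dotProduct, add_comm, mul_comm]
  refine ⟨(∑ i, q i * x i) + (∑ k, u_max / 2 * (a k - |a k|) * H.mulVec x k)
    + (∑ j, gam j * E.mulVec x j * (∑ i, y t i * RE i j)), ⟨?_, ?_⟩, ?_⟩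
  · refine ⟨fun k => if a k ≤ 0 then u_max else 0, fun k => ?_, ?_⟩
    · dsimp only
      split_ifs
      exacts [⟨hu.le, le_rfl⟩, ⟨le_rfl, hu.le⟩]
    · simp only [← mul_ite_nonpos_eq_half_sub_abs, ha]
  · rintro z ⟨u, hmem, rfl⟩
    refine add_le_add_left (add_le_add_right (Finset.sum_le_sum fun k _ => ?_) _) _
    exact mul_le_mul_of_nonneg_right (half_sub_abs_le_mul (hmem k)) (hHx k)
  · have h := congrArg (fun w => dotProduct w x) (hode t ht)
    simp only [haRD, add_dotProduct, smul_dotProduct, zero_dotProduct,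
      ← Matrix.mulVec_mulVec, transpose_mulVec_dotProduct] at h
    have hexit : dotProduct ((Matrix.diagonal gam).mulVec (RE.transpose.mulVec (y t)))
        (E.mulVec x) = ∑ j, gam j * E.mulVec x j * (∑ i, y t i * RE i j) := by
      refine Finset.sum_congr rfl fun j _ => ?_
      have hRE : RE.transpose.mulVec (y t) j = ∑ i, y t i * RE i j := by
        simp [Matrix.mulVec, dotProduct, mul_comm]
      rw [Matrix.mulVec_diagonal, hRE]
      ring
    rw [hexit] at h
    simp only [dotProduct, smul_eq_mul, Finset.mul_sum, ← mul_assoc] at h ⊢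
    linarith
end

section
/- Let T > 0 and let y : ℝ → ℝ^n be differentiable and satisfy, for all t ∈ [0, T], y'(t) + q + Eᵀ Γ R_Eᵀ y(t) + (u_max/2) Hᵀ ( (R_Dᵀ y(t) + v) − |R_Dᵀ y(t) + v|_elem ) = 0. Define the time-varying control u*(t) ∈ ℝ^{m_u} by u*_k(t) := (u_max/2)·(1 − sign( ⟨y(t), r_k^D⟩ + v_k )). Then for every t ∈ [0, T], u*(t) ∈ [0, u_max]^{m_u}, and for every x ∈ ℝ^n with nonnegative entries and every u ∈ [0, u_max]^{m_u}: Σ_{k=1}^{m_u} ( v_k + ⟨y(t), r_k^D⟩ ) u*_k(t) (Hx)_k ≤ Σ_{k=1}^{m_u} ( v_k + ⟨y(t), r_k^D⟩ ) u_k (Hx)_k. In particular the same control u*(t), which does not depend on the state x, attains the minimum in the Hamilton–Jacobi–Bellman equation simultaneously for all nonnegative states x. -/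
theorem Real.half_mul_one_sub_sign_mem_Icc {b : ℝ} (hb : 0 ≤ b) (c : ℝ) :
    b / 2 * (1 - Real.sign c) ∈ Set.Icc 0 b := by
  rcases Real.sign_apply_eq c with h | h | h <;> rw [h] <;> constructor <;> linarith

/-- The bang-bang control `b / 2 * (1 - sign c)` minimizes `w ↦ c * w` over `[0, b]`. -/
theorem Real.mul_half_mul_one_sub_sign_le {b w : ℝ} (c : ℝ) (hw : w ∈ Set.Icc 0 b) :
    c * (b / 2 * (1 - Real.sign c)) ≤ c * w := by
  obtain ⟨h0, hb⟩ := hw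
  rcases lt_trichotomy c 0 with h | rfl | h
  · rw [Real.sign_of_neg h]
    nlinarith
  · simp
  · rw [Real.sign_of_pos h]
    nlinarith

/-- The finite-horizon optimal routing policy of Proposition 1 in feedback-free form:
`u*_k(t) = (u_max/2) * (1 - sign(⟨y(t), r_k^D⟩ + v_k))` is admissible and attains the minimum
in the HJB equation simultaneously for all nonnegative states `x`. -/
theorem finite_horizon_policy_no_state_feedback (n me mu : ℕ)
    (T : ℝ) (hT : 0 < T) (u_max : ℝ) (hu : 0 < u_max)
    (RE : Matrix (Fin n) (Fin me) ℝ) (RD : Matrix (Fin n) (Fin mu) ℝ)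
    (gam : Fin me → ℝ) (hgam : ∀ j, 0 ≤ gam j)
    (E : Matrix (Fin me) (Fin n) ℝ) (hE : ∀ j i, E j i = 0 ∨ E j i = 1)
    (H : Matrix (Fin mu) (Fin n) ℝ) (hH : ∀ k i, H k i = 0 ∨ H k i = 1)
    (q : Fin n → ℝ) (hq : ∀ i, 0 ≤ q i)
    (v : Fin mu → ℝ) (hv : ∀ k, 0 ≤ v k)
    (y y' : ℝ → Fin n → ℝ)
    (hderiv : ∀ t, HasDerivAt y (y' t) t)
    (hode : ∀ t ∈ Set.Icc (0 : ℝ) T,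
      y' t + q + (E.transpose * Matrix.diagonal gam * RE.transpose).mulVec (y t)
        + (u_max / 2) • H.transpose.mulVec
            (fun k => (RD.transpose.mulVec (y t) + v) k
              - |(RD.transpose.mulVec (y t) + v) k|) = 0)
    (ustar : ℝ → Fin mu → ℝ)
    (hustar : ∀ t k, ustar t k
      = (u_max / 2) * (1 - Real.sign ((∑ i, y t i * RD i k) + v k))) :
    ∀ t ∈ Set.Icc (0 : ℝ) T,
      (∀ k, ustar t k ∈ Set.Icc (0 : ℝ) u_max) ∧
      ∀ x : Fin n → ℝ, (∀ i, 0 ≤ x i) →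
        ∀ u : Fin mu → ℝ, (∀ k, u k ∈ Set.Icc (0 : ℝ) u_max) →
          ∑ k, (v k + ∑ i, y t i * RD i k) * ustar t k * H.mulVec x k ≤
            ∑ k, (v k + ∑ i, y t i * RD i k) * u k * H.mulVec x k := by
  refine fun t _ => ⟨fun k => ?_, fun x hx u hu' => Finset.sum_le_sum fun k _ => ?_⟩
  · rw [hustar]
    exact Real.half_mul_one_sub_sign_mem_Icc hu.le _
  · have hHx : 0 ≤ H.mulVec x k := dotProduct_nonneg_of_nonneg (fun i =>
      (hH k i).elim (fun h => h.ge) fun h => h ▸ zero_le_one) hx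
    refine mul_le_mul_of_nonneg_right ?_ hHx
    rw [hustar, add_comm (v k)]
    exact Real.mul_half_mul_one_sub_sign_le _ (hu' k)
end

section
/- Let y ∈ ℝ^n satisfy the algebraic equation q + Eᵀ Γ R_Eᵀ y + (u_max/2) Hᵀ ( (R_Dᵀ y + v) − |R_Dᵀ y + v|_elem ) = 0. Define V(x) := ⟨y, x⟩. Then for every x ∈ ℝ^n with nonnegative entries, V satisfies the stationary (infinite-horizon) Hamilton–Jacobi–Bellman equation: inf over u ∈ [0, u_max]^{m_u} of [ ⟨q, x⟩ + Σ_{k=1}^{m_u} ( v_k + ⟨y, r_k^D⟩ ) u_k (Hx)_k + Σ_{j=1}^{m_e} γ_j (Ex)_j ⟨y, r_j^E⟩ ] = 0, and the infimum is attained. -/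
open Matrix in
/-- Pairing the stationary algebraic equation with a state `x`. -/
theorem stationary_equation_pairing {n me mu : ℕ} {c : ℝ}
    {RE : Matrix (Fin n) (Fin me) ℝ} {gam : Fin me → ℝ}
    {E : Matrix (Fin me) (Fin n) ℝ} {H : Matrix (Fin mu) (Fin n) ℝ}
    {q y : Fin n → ℝ} {w : Fin mu → ℝ}
    (h : q + (Eᵀ * diagonal gam * REᵀ) *ᵥ y + c • Hᵀ *ᵥ w = 0) (x : Fin n → ℝ) :
    (∑ i, q i * x i) + (∑ k, c * w k * (H *ᵥ x) k)
      + (∑ j, gam j * (E *ᵥ x) j * ∑ i, y i * RE i j) = 0 := by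
  have hx : x ⬝ᵥ (q + (Eᵀ * diagonal gam * REᵀ) *ᵥ y + c • Hᵀ *ᵥ w) = 0 := by
    rw [h, dotProduct_zero]
  rw [dotProduct_add, dotProduct_add, dotProduct_smul, ← mulVec_mulVec, ← mulVec_mulVec,
    dotProduct_mulVec x Eᵀ, dotProduct_mulVec x Hᵀ, vecMul_transpose, vecMul_transpose] at hx
  have hq : x ⬝ᵥ q = ∑ i, q i * x i := dotProduct_comm x q
  have hE : (E *ᵥ x) ⬝ᵥ (diagonal gam *ᵥ REᵀ *ᵥ y)
      = ∑ j, gam j * (E *ᵥ x) j * ∑ i, y i * RE i j := by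
    refine Finset.sum_congr rfl fun j _ => ?_
    rw [mulVec_diagonal, mulVec_transpose, vecMul_eq_sum]
    simp only [Finset.sum_apply, Pi.smul_apply, smul_eq_mul]
    ring
  have hH : c • ((H *ᵥ x) ⬝ᵥ w) = ∑ k, c * w k * (H *ᵥ x) k := by
    rw [dotProduct, smul_eq_mul, Finset.mul_sum]
    exact Finset.sum_congr rfl fun k _ => by ring
  rw [hq, hE, hH] at hx
  linarith

/-- On `[0, m]` the function `u ↦ a * u` is bounded below by `m / 2 * (a - |a|)`. -/
theorem half_mul_sub_abs_le_mul {a u m : ℝ} (hu : u ∈ Set.Icc 0 m) :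
    m / 2 * (a - |a|) ≤ a * u := by
  obtain ⟨h0, hm⟩ := hu
  rcases abs_cases a with ⟨h, ha⟩ | ⟨h, ha⟩ <;> rw [h] <;> nlinarith

/-- The bang-bang control attains the minimum of `a * u` over `u ∈ [0, m]`. -/
theorem mul_bang_bang_eq (a m : ℝ) :
    a * (if a < 0 then m else 0) = m / 2 * (a - |a|) := by
  split_ifs with h
  · rw [abs_of_neg h]; ring
  · rw [abs_of_nonneg (not_lt.mp h)]; ring

/-- Verification core of Proposition 2: if `y` solves the stationary algebraic equation, then
`V(x) = ⟨y, x⟩` satisfies the stationary (infinite-horizon) HJB equation at every nonnegative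
state `x`, with the infimum attained. -/
theorem infinite_horizon_hjb_verification (n me mu : ℕ) (u_max : ℝ) (hu : 0 < u_max)
    (RE : Matrix (Fin n) (Fin me) ℝ) (RD : Matrix (Fin n) (Fin mu) ℝ)
    (gam : Fin me → ℝ) (hgam : ∀ j, 0 ≤ gam j)
    (E : Matrix (Fin me) (Fin n) ℝ) (hE : ∀ j i, E j i = 0 ∨ E j i = 1)
    (H : Matrix (Fin mu) (Fin n) ℝ) (hH : ∀ k i, H k i = 0 ∨ H k i = 1)
    (q : Fin n → ℝ) (hq : ∀ i, 0 ≤ q i)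
    (v : Fin mu → ℝ) (hv : ∀ k, 0 ≤ v k)
    (y : Fin n → ℝ)
    (halg : q + (E.transpose * Matrix.diagonal gam * RE.transpose).mulVec y
        + (u_max / 2) • H.transpose.mulVec
            (fun k => (RD.transpose.mulVec y + v) k
              - |(RD.transpose.mulVec y + v) k|) = 0) :
    ∀ x : Fin n → ℝ, (∀ i, 0 ≤ x i) →
      IsLeast {z : ℝ | ∃ u : Fin mu → ℝ, (∀ k, u k ∈ Set.Icc (0 : ℝ) u_max) ∧
          z = (∑ i, q i * x i)
            + (∑ k, (v k + ∑ i, y i * RD i k) * u k * H.mulVec x k)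
            + (∑ j, gam j * E.mulVec x j * (∑ i, y i * RE i j))} 0 := by
  intro x hx
  have hc : ∀ k, (RD.transpose.mulVec y + v) k = v k + ∑ i, y i * RD i k := fun k => by
    rw [Pi.add_apply, add_comm, Matrix.mulVec_transpose, Matrix.vecMul_eq_sum]
    simp only [Finset.sum_apply, Pi.smul_apply, smul_eq_mul]
  simp only [hc] at halg
  have key := stationary_equation_pairing halg x
  constructor
  · refine ⟨fun k => if v k + ∑ i, y i * RD i k < 0 then u_max else 0, fun k => ?_, ?_⟩
    · dsimp only
      split_ifs
      · exact ⟨hu.le, le_rfl⟩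
      · exact ⟨le_rfl, hu.le⟩
    · simp only [mul_bang_bang_eq]
      exact key.symm
  · rintro z ⟨u, hu_mem, rfl⟩
    have hHx : ∀ k, 0 ≤ H.mulVec x k := fun k => by
      refine dotProduct_nonneg_of_nonneg (fun i => ?_) hx
      rcases hH k i with h | h <;> simp [h]
    rw [← key]
    exact add_le_add_left (add_le_add_right (Finset.sum_le_sum fun k _ =>
      mul_le_mul_of_nonneg_right (half_mul_sub_abs_le_mul (hu_mem k)) (hHx k)) _) _
end
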